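/- Assume τ^L, τ^F > 0, ρ(x) > 0 for all x, π^ref(y|x) > 0 and ω^ref(y'|x,y) > 0 for all x, y, y'. Define r(x,y) = min_{q ∈ Δ_Y} [ ∑_{y'} q(y')·p(y ≻ y' | x) + τ^F·KL(q ‖ ω^ref(·|x,y)) ]. Then: (i) r(x,y) = −τ^F·log ∑_{y'} ω^ref(y'|x,y)·exp(−p(y ≻ y' | x)/τ^F); (ii) for every Leader policy π, min over Follower policies ω of f(π,ω) equals ∑_x ρ(x)·[ ∑_y π(y|x)·r(x,y) − τ^L·KL(π(·|x) ‖ π^ref(·|x)) ]; and (iii) this function of π has the unique maximizer π*(y|x) = π^ref(y|x)·exp(r(x,y)/τ^L) / Z(x) with Z(x) = ∑_{y''} π^ref(y''|x)·exp(r(x,y'')/τ^L). -/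

import Mathlib

/-- Kullback–Leibler divergence on a finite type, with the convention `0 · log 0 = 0`. -/
noncomputable def KLd {Y : Type*} [Fintype Y] (q ρ : Y → ℝ) : ℝ :=
  ∑ y, q y * Real.log (q y / ρ y)

section GibbsVariational

variable {Y : Type*} [Fintype Y]

lemma KLd_self (q : Y → ℝ) : KLd q q = 0 := by
  refine Finset.sum_eq_zero fun y _ => ?_
  by_cases h : q y = 0 <;> simp [h]

lemma KLd_eq_sum_klFun {q g : Y → ℝ} (hq : q ∈ stdSimplex ℝ Y) (hg : g ∈ stdSimplex ℝ Y)
    (hgpos : ∀ y, 0 < g y) :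
    KLd q g = ∑ y, g y * InformationTheory.klFun (q y / g y) := by
  have h : ∀ y, g y * InformationTheory.klFun (q y / g y)
      = q y * Real.log (q y / g y) + (g y - q y) := fun y => by
    have := (hgpos y).ne'
    rw [InformationTheory.klFun_apply]
    field_simp
    ring
  simp_rw [h, Finset.sum_add_distrib, Finset.sum_sub_distrib, hq.2, hg.2]
  simp [KLd]

lemma KLd_nonneg {q g : Y → ℝ} (hq : q ∈ stdSimplex ℝ Y) (hg : g ∈ stdSimplex ℝ Y)
    (hgpos : ∀ y, 0 < g y) : 0 ≤ KLd q g := by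
  rw [KLd_eq_sum_klFun hq hg hgpos]
  exact Finset.sum_nonneg fun y _ => mul_nonneg (hgpos y).le
    (InformationTheory.klFun_nonneg (div_nonneg (hq.1 y) (hgpos y).le))

lemma eq_of_KLd_eq_zero {q g : Y → ℝ} (hq : q ∈ stdSimplex ℝ Y) (hg : g ∈ stdSimplex ℝ Y)
    (hgpos : ∀ y, 0 < g y) (h : KLd q g = 0) : q = g := by
  have hnn : ∀ y, 0 ≤ q y / g y := fun y => div_nonneg (hq.1 y) (hgpos y).le
  rw [KLd_eq_sum_klFun hq hg hgpos, Finset.sum_eq_zero_iff_of_nonneg fun y _ =>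
    mul_nonneg (hgpos y).le (InformationTheory.klFun_nonneg (hnn y))] at h
  funext y
  have hy := (mul_eq_zero.1 (h y (Finset.mem_univ y))).resolve_left (hgpos y).ne'
  rw [InformationTheory.klFun_eq_zero_iff (hnn y)] at hy
  exact (div_eq_one_iff_eq (hgpos y).ne').1 hy

/-- The Gibbs distribution with base weights `ρ`, reward `c` and temperature `τ`. -/
noncomputable def gibbs (ρ c : Y → ℝ) (τ : ℝ) (y : Y) : ℝ :=
  ρ y * Real.exp (c y / τ) / ∑ y', ρ y' * Real.exp (c y' / τ)

variable [Nonempty Y] {ρ : Y → ℝ}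

lemma gibbs_partition_pos (hρ : ∀ y, 0 < ρ y) (c : Y → ℝ) (τ : ℝ) :
    0 < ∑ y, ρ y * Real.exp (c y / τ) :=
  Finset.sum_pos (fun y _ => mul_pos (hρ y) (Real.exp_pos _)) Finset.univ_nonempty

lemma gibbs_pos (hρ : ∀ y, 0 < ρ y) (c : Y → ℝ) (τ : ℝ) (y : Y) : 0 < gibbs ρ c τ y :=
  div_pos (mul_pos (hρ y) (Real.exp_pos _)) (gibbs_partition_pos hρ c τ)

lemma gibbs_mem_stdSimplex (hρ : ∀ y, 0 < ρ y) (c : Y → ℝ) (τ : ℝ) :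
    gibbs ρ c τ ∈ stdSimplex ℝ Y := by
  refine ⟨fun y => (gibbs_pos hρ c τ y).le, ?_⟩
  simp only [gibbs]
  rw [← Finset.sum_div, div_self (gibbs_partition_pos hρ c τ).ne']

/-- The Gibbs variational identity. -/
lemma sum_mul_sub_KLd_eq (hρ : ∀ y, 0 < ρ y) (c : Y → ℝ) {τ : ℝ} (hτ : τ ≠ 0)
    {q : Y → ℝ} (hq : q ∈ stdSimplex ℝ Y) :
    (∑ y, q y * c y) - τ * KLd q ρ
      = τ * Real.log (∑ y, ρ y * Real.exp (c y / τ)) - τ * KLd q (gibbs ρ c τ) := by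
  have hZ := gibbs_partition_pos hρ c τ
  have key : ∀ y, τ * (q y * Real.log (q y / gibbs ρ c τ y))
      = τ * (q y * Real.log (q y / ρ y)) - q y * c y
        + q y * (τ * Real.log (∑ y, ρ y * Real.exp (c y / τ))) := fun y => by
    rcases (hq.1 y).eq_or_lt with h | h
    · simp [← h]
    · have hρy := hρ y
      have he := Real.exp_pos (c y / τ)
      rw [Real.log_div h.ne' (gibbs_pos hρ c τ y).ne', Real.log_div h.ne' hρy.ne', gibbs,
        Real.log_div (mul_pos hρy he).ne' hZ.ne', Real.log_mul hρy.ne' he.ne', Real.log_exp]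
      field_simp
      ring
  have hsum : τ * KLd q (gibbs ρ c τ) = τ * KLd q ρ - (∑ y, q y * c y)
      + τ * Real.log (∑ y, ρ y * Real.exp (c y / τ)) := by
    simp only [KLd, Finset.mul_sum]
    rw [Finset.sum_congr rfl fun y _ => key y, Finset.sum_add_distrib, Finset.sum_sub_distrib,
      ← Finset.sum_mul, hq.2, one_mul]
  linarith

/-- The Gibbs variational principle, in its minimization form. -/
lemma isLeast_sum_mul_add_KLd (hρ : ∀ y, 0 < ρ y) (c : Y → ℝ) {τ : ℝ} (hτ : 0 < τ) :
    IsLeast {v : ℝ | ∃ q ∈ stdSimplex ℝ Y, v = (∑ y, q y * c y) + τ * KLd q ρ}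
      (-τ * Real.log (∑ y, ρ y * Real.exp (-(c y) / τ))) := by
  have key : ∀ q ∈ stdSimplex ℝ Y, (∑ y, q y * c y) + τ * KLd q ρ
      = -τ * Real.log (∑ y, ρ y * Real.exp (-(c y) / τ))
        + τ * KLd q (gibbs ρ (fun y => -(c y)) τ) := fun q hq => by
    have h := sum_mul_sub_KLd_eq hρ (fun y => -(c y)) hτ.ne' hq
    simp only [mul_neg, Finset.sum_neg_distrib] at h
    linarith
  have hg := gibbs_mem_stdSimplex hρ (fun y => -(c y)) τ
  refine ⟨⟨_, hg, ?_⟩, ?_⟩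
  · rw [key _ hg, KLd_self, mul_zero, add_zero]
  · rintro _ ⟨q, hq, rfl⟩
    rw [key q hq]
    exact le_add_of_nonneg_right
      (mul_nonneg hτ.le (KLd_nonneg hq hg (gibbs_pos hρ _ τ)))

end GibbsVariational

/-- The Leader's induced reward `r(x,y) = min_q [⟨q, p(y ≻ ·|x)⟩ + τ^F KL(q‖ω^ref)]` has a
log-partition closed form; minimizing the SLHF objective over Followers yields the
KL-regularized Leader objective `L`, whose unique maximizer is the Gibbs policy `π*`.
Here `p x y y'` denotes `p(y ≻ y' | x)`. -/
theorem stmt_3 {X Y : Type*} [Fintype X] [Fintype Y] [Nonempty X] [Nonempty Y]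
    (ρ : X → ℝ) (hρ : ρ ∈ stdSimplex ℝ X) (hρpos : ∀ x, 0 < ρ x)
    (p : X → Y → Y → ℝ) (hp01 : ∀ x y y', p x y y' ∈ Set.Icc (0 : ℝ) 1)
    (hpsym : ∀ x y y', p x y y' + p x y' y = 1)
    (τL τF : ℝ) (hτL : 0 < τL) (hτF : 0 < τF)
    (πref : X → Y → ℝ) (hπref : ∀ x, πref x ∈ stdSimplex ℝ Y)
    (hπrefpos : ∀ x y, 0 < πref x y)
    (ωref : X → Y → Y → ℝ) (hωref : ∀ x y, ωref x y ∈ stdSimplex ℝ Y)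
    (hωrefpos : ∀ x y y', 0 < ωref x y y')
    (r : X → Y → ℝ)
    (hr : ∀ x y, IsLeast
      {v : ℝ | ∃ q ∈ stdSimplex ℝ Y,
        v = (∑ y', q y' * p x y y') + τF * KLd q (ωref x y)} (r x y)) :
    let f : (X → Y → ℝ) → (X → Y → Y → ℝ) → ℝ := fun π ω =>
      ∑ x, ρ x * ((∑ y, π x y *
          ((∑ y', ω x y y' * p x y y') + τF * KLd (ω x y) (ωref x y)))
        - τL * KLd (π x) (πref x))
    let L : (X → Y → ℝ) → ℝ := fun π =>
      ∑ x, ρ x * ((∑ y, π x y * r x y) - τL * KLd (π x) (πref x))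
    let Z : X → ℝ := fun x => ∑ y'', πref x y'' * Real.exp (r x y'' / τL)
    let πstar : X → Y → ℝ := fun x y => πref x y * Real.exp (r x y / τL) / Z x
    -- (i) closed form for r
    (∀ x y, r x y =
      -τF * Real.log (∑ y', ωref x y y' * Real.exp (-(p x y y') / τF))) ∧
    -- (ii) for every Leader policy, min over Followers of f(π,·) equals L π
    (∀ π : X → Y → ℝ, (∀ x, π x ∈ stdSimplex ℝ Y) →
      IsLeast {v : ℝ | ∃ ω : X → Y → Y → ℝ,
        (∀ x y, ω x y ∈ stdSimplex ℝ Y) ∧ v = f π ω} (L π)) ∧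
    -- (iii) unique maximizer of L is the Gibbs policy π*
    ((∀ x, πstar x ∈ stdSimplex ℝ Y) ∧
     (∀ π : X → Y → ℝ, (∀ x, π x ∈ stdSimplex ℝ Y) → L π ≤ L πstar) ∧
     (∀ π : X → Y → ℝ, (∀ x, π x ∈ stdSimplex ℝ Y) → L π = L πstar → π = πstar)) := by
  intro f L Z πstar
  have hstar : ∀ x, πstar x ∈ stdSimplex ℝ Y := fun x =>
    gibbs_mem_stdSimplex (hπrefpos x) (r x) τL
  have hstarpos : ∀ x y, 0 < πstar x y := fun x => gibbs_pos (hπrefpos x) (r x) τL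
  have hgap : ∀ π : X → Y → ℝ, (∀ x, π x ∈ stdSimplex ℝ Y) →
      L π = L πstar - ∑ x, ρ x * (τL * KLd (π x) (πstar x)) := fun π hπ => by
    rw [eq_sub_iff_add_eq]
    simp only [L]
    rw [← Finset.sum_add_distrib]
    refine Finset.sum_congr rfl fun x _ => ?_
    rw [sum_mul_sub_KLd_eq (hπrefpos x) (r x) hτL.ne' (hπ x),
      sum_mul_sub_KLd_eq (hπrefpos x) (r x) hτL.ne' (hstar x)]
    change _ * (_ - τL * KLd (π x) (πstar x)) + _ = _ * (_ - τL * KLd (πstar x) (πstar x))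
    rw [KLd_self]
    ring
  have hnonneg : ∀ π : X → Y → ℝ, (∀ x, π x ∈ stdSimplex ℝ Y) →
      ∀ x ∈ Finset.univ, 0 ≤ ρ x * (τL * KLd (π x) (πstar x)) := fun π hπ x _ =>
    mul_nonneg (hρpos x).le (mul_nonneg hτL.le (KLd_nonneg (hπ x) (hstar x) (hstarpos x)))
  refine ⟨fun x y => (hr x y).unique (isLeast_sum_mul_add_KLd (hωrefpos x y) (p x y) hτF),
    fun π hπ => ⟨?_, ?_⟩, hstar, fun π hπ => ?_, fun π hπ h => ?_⟩
  · choose ω hω hωr using fun x y => (hr x y).1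
    exact ⟨ω, hω, by simp only [f, L, hωr]⟩
  · rintro _ ⟨ω, hω, rfl⟩
    refine Finset.sum_le_sum fun x _ => mul_le_mul_of_nonneg_left
      (sub_le_sub_right (Finset.sum_le_sum fun y _ => mul_le_mul_of_nonneg_left
        ((hr x y).2 ⟨ω x y, hω x y, rfl⟩) ((hπ x).1 y)) _) (hρpos x).le
  · rw [hgap π hπ]
    exact sub_le_self _ (Finset.sum_nonneg (hnonneg π hπ))
  · have hzero : ∑ x, ρ x * (τL * KLd (π x) (πstar x)) = 0 := by
      linarith [hgap π hπ]
    rw [Finset.sum_eq_zero_iff_of_nonneg (hnonneg π hπ)] at hzero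
    funext x
    refine eq_of_KLd_eq_zero (hπ x) (hstar x) (hstarpos x) ?_
    simpa [(hρpos x).ne', hτL.ne'] using hzero x (Finset.mem_univ x)
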